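/- Let (ξ^k)_{k≥1} = (u^k, v^k, w^k)_{k≥1} be the iterates of the HBCD scheme with stepsize η = (ε/‖C̃‖_∞²) · exp(−6‖C‖_∞/ε), and let F* be the optimal value of the dual entropic TiOT problem. Then for every k ≥ 1 the per-iteration error recursion holds: (F(ξ^{k+1}) − F*)² ≤ ρ₁ (F(ξ^k) − F(ξ^{k+1})), where ρ₁ = (192m + 216n + 24) (‖C‖_∞²/ε) exp(18‖C‖_∞/ε). -/

import Mathlib

open Finset Filter Topology

noncomputable section

/-- Cost matrix `C(w)_{ij} = w‖x_i − y_j‖_p^p + (1−w)|t_i − s_j|^p`. -/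
def costM {d m n : ℕ} (p : ℝ) (x : Fin m → Fin d → ℝ) (t : Fin m → ℝ)
    (y : Fin n → Fin d → ℝ) (s : Fin n → ℝ) (w : ℝ) : Matrix (Fin m) (Fin n) ℝ :=
  fun i j => w * (∑ l, |x i l - y j l| ^ p) + (1 - w) * |t i - s j| ^ p

/-- The transport polytope `Π(a,b)`. -/
def transportPolytope {m n : ℕ} (a : Fin m → ℝ) (b : Fin n → ℝ) :
    Set (Matrix (Fin m) (Fin n) ℝ) :=
  {π | (∀ i j, 0 ≤ π i j) ∧ (∀ i, ∑ j, π i j = a i) ∧ (∀ j, ∑ i, π i j = b j)}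

/-- Frobenius pairing `⟨C, π⟩ = Σ_{i,j} C_{ij} π_{ij}`. -/
def ip {m n : ℕ} (C π : Matrix (Fin m) (Fin n) ℝ) : ℝ := ∑ i, ∑ j, C i j * π i j

/-- `KL(π | γ) = Σ_{i,j} (π_{ij} log(π_{ij}/γ_{ij}) − π_{ij} + γ_{ij})` (with `0 log 0 = 0`). -/
def KLdiv {m n : ℕ} (π γ : Matrix (Fin m) (Fin n) ℝ) : ℝ :=
  ∑ i, ∑ j, (π i j * Real.log (π i j / γ i j) - π i j + γ i j)

/-- `C̃_{ij} = ‖x_i − y_j‖_p^p − |t_i − s_j|^p`. -/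
def tildeC {d m n : ℕ} (p : ℝ) (x : Fin m → Fin d → ℝ) (t : Fin m → ℝ)
    (y : Fin n → Fin d → ℝ) (s : Fin n → ℝ) : Matrix (Fin m) (Fin n) ℝ :=
  fun i j => (∑ l, |x i l - y j l| ^ p) - |t i - s j| ^ p

/-- Entrywise sup norm of a matrix. -/
def matSup {m n : ℕ} (C : Matrix (Fin m) (Fin n) ℝ) : ℝ := ⨆ i, ⨆ j, |C i j|

/-- `‖C‖_∞ = max{‖C(0)‖_∞, ‖C(1)‖_∞}`. -/
def CsupNorm {d m n : ℕ} (p : ℝ) (x : Fin m → Fin d → ℝ) (t : Fin m → ℝ)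
    (y : Fin n → Fin d → ℝ) (s : Fin n → ℝ) : ℝ :=
  max (matSup (costM p x t y s 0)) (matSup (costM p x t y s 1))

/-- The dual entropic TiOT objective
`F(u,v,w) = −u^⊤a − v^⊤b + ε Σ_{i,j} exp((u_i + v_j − C(w)_{ij})/ε) a_i b_j − ε`. -/
def Fobj {d m n : ℕ} (p ε : ℝ) (a : Fin m → ℝ) (b : Fin n → ℝ)
    (x : Fin m → Fin d → ℝ) (t : Fin m → ℝ) (y : Fin n → Fin d → ℝ) (s : Fin n → ℝ)
    (u : Fin m → ℝ) (v : Fin n → ℝ) (w : ℝ) : ℝ :=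
  -(∑ i, u i * a i) - (∑ j, v j * b j) +
    ε * (∑ i, ∑ j, Real.exp ((u i + v j - costM p x t y s w i j) / ε) * (a i * b j)) - ε

/-- `∇_w F(u,v,w) = −Σ_{i,j} C̃_{ij} exp((u_i + v_j − C(w)_{ij})/ε) a_i b_j`. -/
def gradW {d m n : ℕ} (p ε : ℝ) (a : Fin m → ℝ) (b : Fin n → ℝ)
    (x : Fin m → Fin d → ℝ) (t : Fin m → ℝ) (y : Fin n → Fin d → ℝ) (s : Fin n → ℝ)
    (u : Fin m → ℝ) (v : Fin n → ℝ) (w : ℝ) : ℝ :=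
  -(∑ i, ∑ j, tildeC p x t y s i j *
      Real.exp ((u i + v j - costM p x t y s w i j) / ε) * (a i * b j))

/-- The HBCD iteration with stepsize `η`: exact minimization in the `u` and `v` blocks
(with the normalization `a^⊤ u^{k+1} = 0`), and one projected gradient step in `w`. -/
def HBCDseq {d m n : ℕ} (p ε η : ℝ) (a : Fin m → ℝ) (b : Fin n → ℝ)
    (x : Fin m → Fin d → ℝ) (t : Fin m → ℝ) (y : Fin n → Fin d → ℝ) (s : Fin n → ℝ)
    (u : ℕ → Fin m → ℝ) (v : ℕ → Fin n → ℝ) (w : ℕ → ℝ) : Prop :=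
  ∀ k : ℕ,
    u (k + 1) = (fun i =>
      -ε * Real.log (∑ j, Real.exp (-costM p x t y s (w k) i j / ε) *
          (Real.exp (v k j / ε) * b j)) +
        ε * ∑ i', a i' * Real.log (∑ j, Real.exp (-costM p x t y s (w k) i' j / ε) *
          (Real.exp (v k j / ε) * b j))) ∧
    v (k + 1) = (fun j =>
      -ε * Real.log (∑ i, Real.exp (-costM p x t y s (w k) i j / ε) *
          (Real.exp (u (k + 1) i / ε) * a i))) ∧
    w (k + 1) = min 1 (max 0
      (w k - η * gradW p ε a b x t y s (u (k + 1)) (v (k + 1)) (w k)))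

/-- The feasible set `{(u,v,w) : a^⊤u = 0, w ∈ [0,1]}` of the dual entropic TiOT problem. -/
def feasSet {m n : ℕ} (a : Fin m → ℝ) : Set ((Fin m → ℝ) × (Fin n → ℝ) × ℝ) :=
  {ζ | (∑ i, a i * ζ.1 i) = 0 ∧ ζ.2.2 ∈ Set.Icc (0 : ℝ) 1}

/-- The set `S̃` of optimal solutions of the dual entropic TiOT minimization problem. -/
def optSet {d m n : ℕ} (p ε : ℝ) (a : Fin m → ℝ) (b : Fin n → ℝ)
    (x : Fin m → Fin d → ℝ) (t : Fin m → ℝ) (y : Fin n → Fin d → ℝ) (s : Fin n → ℝ) :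
    Set ((Fin m → ℝ) × (Fin n → ℝ) × ℝ) :=
  {ζ | ζ ∈ feasSet a ∧ ∀ ζ' ∈ feasSet (n := n) a,
    Fobj p ε a b x t y s ζ.1 ζ.2.1 ζ.2.2 ≤ Fobj p ε a b x t y s ζ'.1 ζ'.2.1 ζ'.2.2}

/-- The optimal value `F*` of the dual entropic TiOT problem. -/
def Fstar {d m n : ℕ} (p ε : ℝ) (a : Fin m → ℝ) (b : Fin n → ℝ)
    (x : Fin m → Fin d → ℝ) (t : Fin m → ℝ) (y : Fin n → Fin d → ℝ) (s : Fin n → ℝ) : ℝ :=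
  sInf {r : ℝ | ∃ ζ : (Fin m → ℝ) × (Fin n → ℝ) × ℝ, ζ ∈ feasSet a ∧
    r = Fobj p ε a b x t y s ζ.1 ζ.2.1 ζ.2.2}

/-- Euclidean (`ℓ²`) distance on `(Fin m → ℝ) × (Fin n → ℝ) × ℝ`. -/
def dist2 {m n : ℕ} (ζ ζ' : (Fin m → ℝ) × (Fin n → ℝ) × ℝ) : ℝ :=
  Real.sqrt ((∑ i, (ζ.1 i - ζ'.1 i) ^ 2) + (∑ j, (ζ.2.1 j - ζ'.2.1 j) ^ 2) +
    (ζ.2.2 - ζ'.2.2) ^ 2)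

/-- Abstract objective with a general cost. -/
def Gob {m n : ℕ} (ε : ℝ) (a : Fin m → ℝ) (b : Fin n → ℝ) (C : Fin m → Fin n → ℝ)
    (u : Fin m → ℝ) (v : Fin n → ℝ) : ℝ :=
  -(∑ i, u i * a i) - (∑ j, v j * b j) +
    ε * (∑ i, ∑ j, Real.exp ((u i + v j - C i j) / ε) * (a i * b j)) - ε

lemma exp_taylor_one (x : ℝ) : Real.exp x - 1 - x ≤ x ^ 2 * Real.exp |x| := by
  have h1 : x + 1 ≤ Real.exp x := Real.add_one_le_exp x
  have h2 : -x + 1 ≤ Real.exp (-x) := Real.add_one_le_exp (-x)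
  have h3 : Real.exp x * Real.exp (-x) = 1 := by rw [← Real.exp_add]; simp
  have hp := Real.exp_pos x
  have h4 : Real.exp x - 1 ≤ x * Real.exp x := by nlinarith
  rcases le_total 0 x with hx | hx
  · rw [abs_of_nonneg hx]
    nlinarith
  · have h5 : 1 ≤ Real.exp |x| := Real.one_le_exp (abs_nonneg x)
    nlinarith [sq_nonneg x]

lemma exp_taylor (x : ℝ) : Real.exp x - 1 - x ≤ 3 / 4 * (x ^ 2 * Real.exp |x|) := by
  obtain ⟨y, rfl⟩ : ∃ y, x = y + y := ⟨x / 2, by ring⟩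
  have h1 := exp_taylor_one y
  have e1 : Real.exp |y + y| = Real.exp |y| * Real.exp |y| := by
    rw [← Real.exp_add, ← two_mul, abs_mul]; congr 1; simp; ring
  rw [e1, Real.exp_add]
  set E := Real.exp |y|
  set e := Real.exp y
  have hE : 1 ≤ E := Real.one_le_exp (abs_nonneg y)
  have hee : e ≤ E := Real.exp_le_exp.mpr (le_abs_self y)
  have h2 : (e - 1) ^ 2 ≤ (|y| * E) ^ 2 := by
    apply sq_le_sq'
    · have : y + 1 ≤ e := Real.add_one_le_exp y
      have := neg_abs_le y
      nlinarith [abs_nonneg y]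
    · have h2 : -y + 1 ≤ Real.exp (-y) := Real.add_one_le_exp (-y)
      have h3 : e * Real.exp (-y) = 1 := by simp only [e]; rw [← Real.exp_add]; simp
      have h4 : e - 1 ≤ y * e := by nlinarith [Real.exp_pos y]
      have h5 : y * e ≤ |y| * e := mul_le_mul_of_nonneg_right (le_abs_self y) (Real.exp_pos y).le
      have h6 : |y| * e ≤ |y| * E := mul_le_mul_of_nonneg_left hee (abs_nonneg y)
      linarith
  rw [mul_pow, sq_abs] at h2
  have h7 : y ^ 2 * E ≤ y ^ 2 * (E * E) :=
    mul_le_mul_of_nonneg_left (by nlinarith) (sq_nonneg y)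
  nlinarith

lemma G_convex {m n : ℕ} (ε : ℝ) (hε : 0 < ε) (a : Fin m → ℝ) (b : Fin n → ℝ)
    (ha : ∀ i, 0 < a i) (hb : ∀ j, 0 < b j)
    (C C' : Fin m → Fin n → ℝ) (u u' : Fin m → ℝ) (v v' : Fin n → ℝ)
    (hcol : ∀ j, ∑ i, Real.exp ((u i + v j - C i j) / ε) * (a i * b j) = b j) :
    Gob ε a b C u v - Gob ε a b C' u' v' ≤
      ∑ i, (∑ j, Real.exp ((u i + v j - C i j) / ε) * (a i * b j) - a i) * (u i - u' i) +
      ∑ i, ∑ j, (C' i j - C i j) * (Real.exp ((u i + v j - C i j) / ε) * (a i * b j)) := by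
  have key : ∀ i j, ε * (Real.exp ((u i + v j - C i j) / ε) * (a i * b j))
      - ε * (Real.exp ((u' i + v' j - C' i j) / ε) * (a i * b j)) ≤
      Real.exp ((u i + v j - C i j) / ε) * (a i * b j) * (u i - u' i) +
      Real.exp ((u i + v j - C i j) / ε) * (a i * b j) * (v j - v' j) +
      (C' i j - C i j) * (Real.exp ((u i + v j - C i j) / ε) * (a i * b j)) := by
    intro i j
    set X := (u i + v j - C i j) / ε with hX
    set Y := (u' i + v' j - C' i j) / ε with hY
    have h1 : Real.exp X * (Y - X + 1) ≤ Real.exp Y := by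
      have := Real.add_one_le_exp (Y - X)
      have h2 : Real.exp Y = Real.exp X * Real.exp (Y - X) := by rw [← Real.exp_add]; ring_nf
      rw [h2]
      exact mul_le_mul_of_nonneg_left this (Real.exp_pos X).le
    have h3 : ε * (Y - X) = (u' i - u i) + (v' j - v j) - (C' i j - C i j) := by
      rw [hX, hY]; field_simp; ring
    have hab : 0 < a i * b j := mul_pos (ha i) (hb j)
    have h4 := mul_le_mul_of_nonneg_left h1 (mul_pos hε hab).le
    have h5 : ε * (a i * b j) * (Real.exp X * (Y - X + 1)) =
        (a i * b j) * Real.exp X * (ε * (Y - X)) + ε * (Real.exp X * (a i * b j)) := by ring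
    rw [h5, h3] at h4
    nlinarith
  have hs : ∑ i, ∑ j, (ε * (Real.exp ((u i + v j - C i j) / ε) * (a i * b j))
      - ε * (Real.exp ((u' i + v' j - C' i j) / ε) * (a i * b j))) ≤ _ :=
    Finset.sum_le_sum fun i _ => Finset.sum_le_sum fun j _ => key i j
  simp only [Finset.sum_add_distrib, Finset.sum_sub_distrib, ← Finset.mul_sum] at hs
  have hv : ∑ i, ∑ j, Real.exp ((u i + v j - C i j) / ε) * (a i * b j) * (v j - v' j)
      = ∑ j, b j * (v j - v' j) := by
    rw [Finset.sum_comm]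
    refine Finset.sum_congr rfl fun j _ => ?_
    rw [← Finset.sum_mul, hcol]
  have hu : ∑ i, (∑ j, Real.exp ((u i + v j - C i j) / ε) * (a i * b j) - a i) * (u i - u' i)
      = ∑ i, ∑ j, Real.exp ((u i + v j - C i j) / ε) * (a i * b j) * (u i - u' i)
        - ∑ i, u i * a i + ∑ i, u' i * a i := by
    rw [← Finset.sum_sub_distrib, ← Finset.sum_add_distrib]
    refine Finset.sum_congr rfl fun i _ => ?_
    rw [← Finset.sum_mul]; ring
  have hv2 : ∑ j, b j * (v j - v' j) = ∑ j, v j * b j - ∑ j, v' j * b j := by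
    rw [← Finset.sum_sub_distrib]
    exact Finset.sum_congr rfl fun j _ => by ring
  rw [hv, hv2] at hs
  rw [hu]
  unfold Gob
  simp only [← Finset.sum_mul] at hs ⊢
  linarith

lemma G_smooth {m n : ℕ} (ε : ℝ) (hε : 0 < ε) (a : Fin m → ℝ) (b : Fin n → ℝ)
    (ha : ∀ i, 0 < a i) (hb : ∀ j, 0 < b j)
    (C C' : Fin m → Fin n → ℝ) (u : Fin m → ℝ) (v : Fin n → ℝ) (δ M : ℝ)
    (hd : ∀ i j, |C i j - C' i j| ≤ δ) (hδM : δ ≤ M)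
    (hmass : ∑ i, ∑ j, Real.exp ((u i + v j - C i j) / ε) * (a i * b j) = 1) :
    Gob ε a b C' u v - Gob ε a b C u v ≤
      ∑ i, ∑ j, (C i j - C' i j) * (Real.exp ((u i + v j - C i j) / ε) * (a i * b j)) +
      3 / 4 * (δ ^ 2 / ε * Real.exp (M / ε)) := by
  have key : ∀ i j, ε * (Real.exp ((u i + v j - C' i j) / ε) * (a i * b j))
      - ε * (Real.exp ((u i + v j - C i j) / ε) * (a i * b j)) ≤
      (C i j - C' i j) * (Real.exp ((u i + v j - C i j) / ε) * (a i * b j)) +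
      3 / 4 * (δ ^ 2 / ε * Real.exp (M / ε)) *
        (Real.exp ((u i + v j - C i j) / ε) * (a i * b j)) := by
    intro i j
    set P := Real.exp ((u i + v j - C i j) / ε) * (a i * b j) with hP
    have hPpos : 0 < P := mul_pos (Real.exp_pos _) (mul_pos (ha i) (hb j))
    set h := C i j - C' i j with hh
    have e1 : Real.exp ((u i + v j - C' i j) / ε) * (a i * b j) = Real.exp (h / ε) * P := by
      have : Real.exp ((u i + v j - C' i j) / ε) =
          Real.exp (h / ε) * Real.exp ((u i + v j - C i j) / ε) := by
        rw [← Real.exp_add]; congr 1; rw [hh]; field_simp; ring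
      rw [hP, this]; ring
    rw [e1]
    have h1 := exp_taylor (h / ε)
    have hdh : |h| ≤ δ := hd i j
    have h2 : Real.exp |h / ε| ≤ Real.exp (M / ε) := by
      rw [Real.exp_le_exp, abs_div, abs_of_pos hε]
      gcongr; linarith
    have h3 : (h / ε) ^ 2 ≤ δ ^ 2 / ε ^ 2 := by
      rw [div_pow, ← sq_abs h]; gcongr
    have h4 : (h / ε) ^ 2 * Real.exp |h / ε| ≤ δ ^ 2 / ε ^ 2 * Real.exp (M / ε) := by gcongr
    have h5 : Real.exp (h / ε) - 1 - h / ε ≤ 3 / 4 * (δ ^ 2 / ε ^ 2 * Real.exp (M / ε)) := by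
      linarith
    have h6 := mul_le_mul_of_nonneg_left h5 (mul_pos hε hPpos).le
    have h7 : ε * P * (Real.exp (h / ε) - 1 - h / ε)
        = ε * (Real.exp (h / ε) * P) - ε * P - h * P := by field_simp
    have h8 : ε * P * (3 / 4 * (δ ^ 2 / ε ^ 2 * Real.exp (M / ε)))
        = 3 / 4 * (δ ^ 2 / ε * Real.exp (M / ε)) * P := by field_simp
    linarith
  have hs : ∑ i, ∑ j, (ε * (Real.exp ((u i + v j - C' i j) / ε) * (a i * b j))
      - ε * (Real.exp ((u i + v j - C i j) / ε) * (a i * b j))) ≤ _ :=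
    Finset.sum_le_sum fun i _ => Finset.sum_le_sum fun j _ => key i j
  simp only [Finset.sum_add_distrib, Finset.sum_sub_distrib, ← Finset.mul_sum] at hs
  rw [hmass] at hs
  unfold Gob
  rw [hmass]
  linarith

/-- One exact `(u,v)` step. -/
lemma G_step {m n : ℕ} (ε : ℝ) (hε : 0 < ε) (a : Fin m → ℝ) (b : Fin n → ℝ)
    (ha : ∀ i, 0 < a i) (ha1 : ∑ i, a i = 1) (hb : ∀ j, 0 < b j) (hb1 : ∑ j, b j = 1)
    (hm : 1 ≤ m) (hn : 1 ≤ n)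
    (C : Fin m → Fin n → ℝ) (M : ℝ) (hC0 : ∀ i j, 0 ≤ C i j) (hCM : ∀ i j, C i j ≤ M)
    (v V : Fin n → ℝ) (U : Fin m → ℝ)
    (hU : U = (fun i =>
      -ε * Real.log (∑ j, Real.exp (-C i j / ε) * (Real.exp (v j / ε) * b j)) +
        ε * ∑ i', a i' * Real.log (∑ j, Real.exp (-C i' j / ε) *
          (Real.exp (v j / ε) * b j))))
    (hV : V = (fun j =>
      -ε * Real.log (∑ i, Real.exp (-C i j / ε) * (Real.exp (U i / ε) * a i)))) :
    (∑ i, a i * U i = 0) ∧ (∀ i, |U i| ≤ M) ∧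
    (∀ j, ∑ i, Real.exp ((U i + V j - C i j) / ε) * (a i * b j) = b j) ∧
    (∀ u' : Fin m → ℝ, ∑ i, a i * u' i = 0 →
      ε / 4 * (∑ i, |∑ j, Real.exp ((U i + V j - C i j) / ε) * (a i * b j) - a i|) ^ 2 ≤
        Gob ε a b C u' v - Gob ε a b C U V) := by
  have : Nonempty (Fin m) := ⟨⟨0, hm⟩⟩
  have : Nonempty (Fin n) := ⟨⟨0, hn⟩⟩
  obtain ⟨K, hK⟩ : ∃ K : Fin m → ℝ, K = fun i =>
      ∑ j, Real.exp (-C i j / ε) * (Real.exp (v j / ε) * b j) := ⟨_, rfl⟩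
  have hKpos : ∀ i, 0 < K i := by
    intro i; rw [hK]
    exact Finset.sum_pos (fun j _ => mul_pos (Real.exp_pos _)
      (mul_pos (Real.exp_pos _) (hb j))) Finset.univ_nonempty
  obtain ⟨L, hL⟩ : ∃ L : ℝ, L = ε * ∑ i, a i * Real.log (K i) := ⟨_, rfl⟩
  have hUi : ∀ i, U i = -ε * Real.log (K i) + L := by
    intro i; rw [hU, hL, hK]
  have hVe : ∀ j, Real.exp (-V j / ε) =
      ∑ i, Real.exp (-C i j / ε) * (Real.exp (U i / ε) * a i) := by
    intro j
    have hpos : 0 < ∑ i, Real.exp (-C i j / ε) * (Real.exp (U i / ε) * a i) :=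
      Finset.sum_pos (fun i _ => mul_pos (Real.exp_pos _)
        (mul_pos (Real.exp_pos _) (ha i))) Finset.univ_nonempty
    have : -V j / ε = Real.log (∑ i, Real.exp (-C i j / ε) * (Real.exp (U i / ε) * a i)) := by
      rw [hV]; field_simp
    rw [this, Real.exp_log hpos]
  have hU0 : ∑ i, a i * U i = 0 := by
    have : ∑ i, a i * U i = -ε * ∑ i, a i * Real.log (K i) + (∑ i, a i) * L := by
      rw [Finset.mul_sum, Finset.sum_mul, ← Finset.sum_add_distrib]
      exact Finset.sum_congr rfl fun i _ => by rw [hUi]; ring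
    rw [this, ha1, hL]; ring
  have hcol : ∀ j, ∑ i, Real.exp ((U i + V j - C i j) / ε) * (a i * b j) = b j := by
    intro j
    have : ∑ i, Real.exp ((U i + V j - C i j) / ε) * (a i * b j) =
        (Real.exp (V j / ε) * b j) *
          ∑ i, Real.exp (-C i j / ε) * (Real.exp (U i / ε) * a i) := by
      rw [Finset.mul_sum]
      refine Finset.sum_congr rfl fun i _ => ?_
      have : Real.exp ((U i + V j - C i j) / ε) =
          Real.exp (V j / ε) * (Real.exp (-C i j / ε) * Real.exp (U i / ε)) := by
        rw [← Real.exp_add, ← Real.exp_add]; congr 1; ring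
      rw [this]; ring
    rw [this, ← hVe]
    have : Real.exp (V j / ε) * Real.exp (-V j / ε) = 1 := by
      rw [← Real.exp_add, neg_div]; simp
    linear_combination b j * this
  have hlog : ∀ i i', Real.log (K i) - Real.log (K i') ≤ M / ε := by
    intro i i'
    have h1 : K i ≤ Real.exp (M / ε) * K i' := by
      rw [hK]; simp only [Finset.mul_sum]
      refine Finset.sum_le_sum fun j _ => ?_
      rw [← mul_assoc (Real.exp (M / ε)), ← Real.exp_add]
      apply mul_le_mul_of_nonneg_right _ (mul_pos (Real.exp_pos _) (hb j)).le
      rw [Real.exp_le_exp, ← add_div]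
      have := hC0 i j; have := hCM i' j
      gcongr; linarith
    have h2 := Real.log_le_log (hKpos i) h1
    rw [Real.log_mul (Real.exp_pos _).ne' (hKpos i').ne', Real.log_exp] at h2
    linarith
  have hUM : ∀ i, |U i| ≤ M := by
    intro i
    have h1 : U i = ε * ∑ i', a i' * (Real.log (K i') - Real.log (K i)) := by
      simp only [mul_sub, Finset.sum_sub_distrib]
      rw [← Finset.sum_mul, ha1, hUi, hL]; ring
    have h2 : ∑ i', a i' * (Real.log (K i') - Real.log (K i)) ≤ ∑ i', a i' * (M / ε) :=
      Finset.sum_le_sum fun i' _ => mul_le_mul_of_nonneg_left (hlog i' i) (ha i').le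
    have h3 : ∑ i', a i' * (-(M / ε)) ≤ ∑ i', a i' * (Real.log (K i') - Real.log (K i)) :=
      Finset.sum_le_sum fun i' _ => mul_le_mul_of_nonneg_left
        (by linarith [hlog i i']) (ha i').le
    rw [← Finset.sum_mul, ha1, one_mul] at h2 h3
    have hM : ε * (M / ε) = M := by field_simp
    rw [h1, abs_le]
    constructor
    · nlinarith
    · nlinarith
  refine ⟨hU0, hUM, hcol, ?_⟩
  intro u' hu'
  have hGUV : Gob ε a b C U V = -∑ j, V j * b j := by
    have h1 : ∑ i, U i * a i = 0 := by rw [← hU0]; exact Finset.sum_congr rfl fun i _ => by ring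
    unfold Gob
    rw [Finset.sum_comm (f := fun i j => Real.exp ((U i + V j - C i j) / ε) * (a i * b j)), h1]
    simp only [hcol, hb1]; ring
  have hGu : -(∑ j, v j * b j) + L ≤ Gob ε a b C u' v := by
    have h1 : ∑ i, u' i * a i = 0 := by rw [← hu']; exact Finset.sum_congr rfl fun i _ => by ring
    have h2 : ∀ i, a i * u' i + ε * (a i * Real.log (K i)) + ε * a i ≤
        ε * ∑ j, Real.exp ((u' i + v j - C i j) / ε) * (a i * b j) := by
      intro i
      have h3 : ∑ j, Real.exp ((u' i + v j - C i j) / ε) * (a i * b j) =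
          a i * Real.exp (u' i / ε + Real.log (K i)) := by
        rw [Real.exp_add, Real.exp_log (hKpos i), hK]
        simp only [Finset.mul_sum]
        refine Finset.sum_congr rfl fun j _ => ?_
        have : Real.exp ((u' i + v j - C i j) / ε) =
            Real.exp (u' i / ε) * (Real.exp (-C i j / ε) * Real.exp (v j / ε)) := by
          rw [← Real.exp_add, ← Real.exp_add]; congr 1; ring
        rw [this]; ring
      rw [h3]
      have h4 := mul_le_mul_of_nonneg_left (Real.add_one_le_exp (u' i / ε + Real.log (K i)))
        (mul_pos hε (ha i)).le
      have h5 : ε * a i * (u' i / ε + Real.log (K i) + 1) =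
        a i * u' i + ε * (a i * Real.log (K i)) + ε * a i := by field_simp
      rw [h5] at h4
      linarith
    have h6 := Finset.sum_le_sum fun i (_ : i ∈ Finset.univ) => h2 i
    simp only [Finset.sum_add_distrib, ← Finset.mul_sum] at h6
    rw [hu', ha1, ← hL] at h6
    unfold Gob
    rw [h1]
    linarith
  obtain ⟨h, hh⟩ : ∃ h : Fin n → ℝ, h = fun j => Real.exp ((v j - V j - L) / (2 * ε)) := ⟨_, rfl⟩
  have hhpos : ∀ j, 0 < h j := fun j => by rw [hh]; exact Real.exp_pos _
  have hh2 : ∀ j, h j ^ 2 = Real.exp ((v j - V j - L) / ε) := by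
    intro j; rw [hh]; simp only []; rw [sq, ← Real.exp_add]; congr 1; field_simp; ring
  have hrow : ∀ i, ∑ j, Real.exp ((U i + V j - C i j) / ε) * (a i * b j) * h j ^ 2 = a i := by
    intro i
    have h1 : Real.exp ((U i - L) / ε) * K i = 1 := by
      have : (U i - L) / ε = -Real.log (K i) := by rw [hUi]; field_simp; ring
      rw [this, Real.exp_neg, Real.exp_log (hKpos i), inv_mul_cancel₀ (hKpos i).ne']
    have h2 : ∑ j, Real.exp ((U i + V j - C i j) / ε) * (a i * b j) * h j ^ 2 =
        a i * (Real.exp ((U i - L) / ε) * K i) := by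
      rw [hK]; simp only [Finset.mul_sum]
      refine Finset.sum_congr rfl fun j _ => ?_
      have : Real.exp ((U i + V j - C i j) / ε) * h j ^ 2 =
          Real.exp ((U i - L) / ε) * (Real.exp (-C i j / ε) * Real.exp (v j / ε)) := by
        rw [hh2, ← Real.exp_add, ← Real.exp_add, ← Real.exp_add]; congr 1; ring
      linear_combination (a i * b j) * this
    rw [h2, h1, mul_one]
  have hbh : ∑ j, b j * h j ^ 2 = 1 := by
    rw [← ha1, ← Finset.sum_congr rfl fun i _ => hrow i, Finset.sum_comm]
    refine Finset.sum_congr rfl fun j _ => ?_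
    rw [← Finset.sum_mul, hcol]
  -- l1 bound
  have hl1 : ∑ i, |∑ j, Real.exp ((U i + V j - C i j) / ε) * (a i * b j) - a i| ≤
      ∑ j, b j * |1 - h j ^ 2| := by
    calc _ ≤ ∑ i, ∑ j, Real.exp ((U i + V j - C i j) / ε) * (a i * b j) * |1 - h j ^ 2| := by
          refine Finset.sum_le_sum fun i _ => ?_
          have : ∑ j, Real.exp ((U i + V j - C i j) / ε) * (a i * b j) - a i =
              ∑ j, Real.exp ((U i + V j - C i j) / ε) * (a i * b j) * (1 - h j ^ 2) := by
            simp only [mul_sub, mul_one, Finset.sum_sub_distrib]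
            rw [hrow]
          rw [this]
          refine (Finset.abs_sum_le_sum_abs _ _).trans (Finset.sum_le_sum fun j _ => ?_)
          rw [abs_mul, abs_of_pos (mul_pos (Real.exp_pos _) (mul_pos (ha i) (hb j)))]
      _ = _ := by
          rw [Finset.sum_comm]
          refine Finset.sum_congr rfl fun j _ => ?_
          rw [← Finset.sum_mul, hcol]
  have hE : (∑ j, b j * |1 - h j ^ 2|) ^ 2 ≤ 4 * ∑ j, b j * (1 - h j) ^ 2 := by
    have hcs := Finset.sum_mul_sq_le_sq_mul_sq Finset.univ
      (fun j => Real.sqrt (b j) * |1 - h j|) (fun j => Real.sqrt (b j) * (1 + h j))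
    have e1 : ∑ j, (Real.sqrt (b j) * |1 - h j|) * (Real.sqrt (b j) * (1 + h j)) =
        ∑ j, b j * |1 - h j ^ 2| := by
      refine Finset.sum_congr rfl fun j _ => ?_
      have : 1 - h j ^ 2 = (1 - h j) * (1 + h j) := by ring
      rw [this, abs_mul, abs_of_pos (by linarith [hhpos j] : 0 < 1 + h j)]
      have := Real.mul_self_sqrt (hb j).le
      linear_combination (|1 - h j| * (1 + h j)) * this
    have e2 : ∑ j, (Real.sqrt (b j) * |1 - h j|) ^ 2 = ∑ j, b j * (1 - h j) ^ 2 := by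
      refine Finset.sum_congr rfl fun j _ => ?_
      rw [mul_pow, Real.sq_sqrt (hb j).le, sq_abs]
    have e3 : ∑ j, (Real.sqrt (b j) * (1 + h j)) ^ 2 ≤ 4 := by
      calc _ ≤ ∑ j, (2 * b j + 2 * (b j * h j ^ 2)) := by
            refine Finset.sum_le_sum fun j _ => ?_
            rw [mul_pow, Real.sq_sqrt (hb j).le]
            nlinarith [mul_nonneg (hb j).le (sq_nonneg (1 - h j))]
        _ = 4 := by
            rw [Finset.sum_add_distrib, ← Finset.mul_sum, ← Finset.mul_sum, hb1, hbh]; norm_num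
    rw [e1, e2] at hcs
    have : 0 ≤ ∑ j, b j * (1 - h j) ^ 2 :=
      Finset.sum_nonneg fun j _ => mul_nonneg (hb j).le (sq_nonneg _)
    nlinarith
  have hdrop : ε * ∑ j, b j * (1 - h j) ^ 2 ≤ ∑ j, V j * b j - ∑ j, v j * b j + L := by
    have e1 : ∑ j, b j * (1 - h j) ^ 2 = ∑ j, 2 * b j * (1 - h j) := by
      have : ∑ j, b j * (1 - h j) ^ 2 = ∑ j, 2 * b j * (1 - h j) - ∑ j, b j
          + ∑ j, b j * h j ^ 2 := by
        rw [← Finset.sum_sub_distrib, ← Finset.sum_add_distrib]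
        exact Finset.sum_congr rfl fun j _ => by ring
      rw [this, hb1, hbh]; ring
    have e2 : ∑ j, V j * b j - ∑ j, v j * b j + L = ∑ j, b j * (V j - v j + L) := by
      have : L = ∑ j, b j * L := by rw [← Finset.sum_mul, hb1, one_mul]
      conv_lhs => rw [this]
      rw [← Finset.sum_sub_distrib, ← Finset.sum_add_distrib]
      exact Finset.sum_congr rfl fun j _ => by ring
    rw [e1, e2, Finset.mul_sum]
    refine Finset.sum_le_sum fun j _ => ?_
    have h1 : (v j - V j - L) / (2 * ε) + 1 ≤ h j := by
      rw [hh]; exact Real.add_one_le_exp _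
    have h2 := mul_le_mul_of_nonneg_left h1 (mul_pos (mul_pos two_pos hε) (hb j)).le
    have h3 : 2 * ε * b j * ((v j - V j - L) / (2 * ε) + 1) =
      b j * (v j - V j - L) + 2 * ε * b j := by field_simp
    rw [h3] at h2
    linarith
  have hnn : 0 ≤ ∑ i, |∑ j, Real.exp ((U i + V j - C i j) / ε) * (a i * b j) - a i| :=
    Finset.sum_nonneg fun i _ => abs_nonneg _
  have hsq := pow_le_pow_left₀ hnn hl1 2
  have := mul_le_mul_of_nonneg_left (hsq.trans hE) (by positivity : 0 ≤ ε / 4)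
  linarith

lemma matSup_bound {m n : ℕ} (C : Matrix (Fin m) (Fin n) ℝ) (i : Fin m) (j : Fin n) :
    |C i j| ≤ matSup C := by
  unfold matSup
  exact (le_ciSup (f := fun j => |C i j|) (Set.finite_range _).bddAbove j).trans
    (le_ciSup (f := fun i => ⨆ j, |C i j|) (Set.finite_range _).bddAbove i)

set_option maxHeartbeats 2000000

/-- Per-iteration error recursion for HBCD with stepsize
`η = (ε/‖C̃‖_∞²) exp(−6‖C‖_∞/ε)`: for every `k ≥ 1`,
`(F(ξ^{k+1}) − F*)² ≤ ρ₁ (F(ξ^k) − F(ξ^{k+1}))` with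
`ρ₁ = (192m + 216n + 24)(‖C‖_∞²/ε) exp(18‖C‖_∞/ε)`. -/
theorem HBCD_error_recursion {d m n : ℕ} (hm : 1 ≤ m) (hn : 1 ≤ n)
    (p ε η : ℝ) (hp : 1 ≤ p) (hε : 0 < ε)
    (a : Fin m → ℝ) (b : Fin n → ℝ)
    (ha : ∀ i, 0 < a i) (ha1 : ∑ i, a i = 1) (hb : ∀ j, 0 < b j) (hb1 : ∑ j, b j = 1)
    (x : Fin m → Fin d → ℝ) (t : Fin m → ℝ) (y : Fin n → Fin d → ℝ) (s : Fin n → ℝ)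
    (hη : η = (ε / matSup (tildeC p x t y s) ^ 2) *
      Real.exp (-(6 * CsupNorm p x t y s) / ε))
    (u : ℕ → Fin m → ℝ) (v : ℕ → Fin n → ℝ) (w : ℕ → ℝ)
    (hw0 : w 0 ∈ Set.Icc (0 : ℝ) 1)
    (hseq : HBCDseq p ε η a b x t y s u v w) :
    ∀ k : ℕ, 1 ≤ k →
      (Fobj p ε a b x t y s (u (k + 1)) (v (k + 1)) (w (k + 1)) -
          Fstar p ε a b x t y s) ^ 2 ≤
        ((192 * (m : ℝ) + 216 * (n : ℝ) + 24) * (CsupNorm p x t y s ^ 2 / ε) *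
            Real.exp (18 * CsupNorm p x t y s / ε)) *
          (Fobj p ε a b x t y s (u k) (v k) (w k) -
            Fobj p ε a b x t y s (u (k + 1)) (v (k + 1)) (w (k + 1))) := by
  intro k hk
  have : Nonempty (Fin m) := ⟨⟨0, hm⟩⟩
  have : Nonempty (Fin n) := ⟨⟨0, hn⟩⟩
  obtain ⟨M, hM⟩ : ∃ M, M = CsupNorm p x t y s := ⟨_, rfl⟩
  obtain ⟨T, hT⟩ : ∃ T, T = matSup (tildeC p x t y s) := ⟨_, rfl⟩
  rw [← hM] at hη ⊢
  rw [← hT] at hη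
  -- bounds on the cost
  have h0 : ∀ i j, 0 ≤ |t i - s j| ^ p ∧ |t i - s j| ^ p ≤ M := by
    intro i j
    refine ⟨Real.rpow_nonneg (abs_nonneg _) _, ?_⟩
    have := (le_abs_self _).trans ((matSup_bound (costM p x t y s 0) i j).trans (le_max_left _
      (matSup (costM p x t y s 1))))
    rw [hM]; unfold CsupNorm
    simpa [costM] using this
  have h1 : ∀ i j, 0 ≤ (∑ l, |x i l - y j l| ^ p) ∧ (∑ l, |x i l - y j l| ^ p) ≤ M := by
    intro i j
    refine ⟨Finset.sum_nonneg fun l _ => Real.rpow_nonneg (abs_nonneg _) _, ?_⟩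
    have := (le_abs_self _).trans ((matSup_bound (costM p x t y s 1) i j).trans (le_max_right
      (matSup (costM p x t y s 0)) _))
    rw [hM]; unfold CsupNorm
    have e : costM p x t y s 1 i j = ∑ l, |x i l - y j l| ^ p := by simp [costM]
    rw [e] at this
    exact this
  have hM0 : 0 ≤ M := (h0 ⟨0, hm⟩ ⟨0, hn⟩).1.trans (h0 ⟨0, hm⟩ ⟨0, hn⟩).2
  have htT : ∀ i j, |tildeC p x t y s i j| ≤ T := fun i j => hT ▸ matSup_bound _ i j
  have hT0 : 0 ≤ T := (abs_nonneg _).trans (htT ⟨0, hm⟩ ⟨0, hn⟩)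
  have hTM : T ≤ M := by
    rw [hT]; unfold matSup
    refine ciSup_le fun i => ciSup_le fun j => ?_
    unfold tildeC
    rw [abs_le]
    constructor <;> linarith [(h0 i j).1, (h0 i j).2, (h1 i j).1, (h1 i j).2]
  have hC0 : ∀ w' ∈ Set.Icc (0 : ℝ) 1, ∀ i j, 0 ≤ costM p x t y s w' i j := by
    intro w' hw' i j
    exact add_nonneg (mul_nonneg hw'.1 (h1 i j).1) (mul_nonneg (by linarith [hw'.2]) (h0 i j).1)
  have hCM : ∀ w' ∈ Set.Icc (0 : ℝ) 1, ∀ i j, costM p x t y s w' i j ≤ M := by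
    intro w' hw' i j
    have e1 := mul_le_mul_of_nonneg_left (h1 i j).2 hw'.1
    have e2 := mul_le_mul_of_nonneg_left (h0 i j).2 (by linarith [hw'.2] : 0 ≤ 1 - w')
    unfold costM
    linarith
  have hCd : ∀ w1 w2 i j, costM p x t y s w1 i j - costM p x t y s w2 i j =
      (w1 - w2) * tildeC p x t y s i j := by
    intro w1 w2 i j; unfold costM tildeC; ring
  have hw : ∀ k, w k ∈ Set.Icc (0 : ℝ) 1 := by
    intro k
    rcases k with _ | k
    · exact hw0
    · rw [(hseq k).2.2]
      exact ⟨le_min zero_le_one (le_max_left _ _), min_le_left _ _⟩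
  have hFG : ∀ u v w', Fobj p ε a b x t y s u v w' = Gob ε a b (costM p x t y s w') u v :=
    fun _ _ _ => rfl
  -- a general step
  have step := fun (w' : ℝ) (hw' : w' ∈ Set.Icc (0 : ℝ) 1) (v V : Fin n → ℝ) (U : Fin m → ℝ) =>
    G_step ε hε a b ha ha1 hb hb1 hm hn (costM p x t y s w') M (hC0 w' hw') (hCM w' hw') v V U
  obtain ⟨hU0, hUM, hcol, hdrop⟩ := step (w k) (hw k) (v k) (v (k + 1)) (u (k + 1))
    (hseq k).1 (hseq k).2.1
  have huk : ∑ i, a i * u k i = 0 := by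
    obtain ⟨k', rfl⟩ : ∃ k', k = k' + 1 := ⟨k - 1, by omega⟩
    exact (step (w k') (hw k') (v k') (v (k' + 1)) (u (k' + 1)) (hseq k').1 (hseq k').2.1).1
  have hdrop := hdrop (u k) huk
  have hwk := hw k
  have hwk1 := hw (k + 1)
  have hwdef := (hseq k).2.2
  simp only [hFG]
  obtain ⟨U, hUd⟩ : ∃ U, U = u (k + 1) := ⟨_, rfl⟩
  obtain ⟨V, hVd⟩ : ∃ V, V = v (k + 1) := ⟨_, rfl⟩
  obtain ⟨W, hWd⟩ : ∃ W, W = w (k + 1) := ⟨_, rfl⟩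
  obtain ⟨w0, hw0d⟩ : ∃ w0, w0 = w k := ⟨_, rfl⟩
  rw [← hUd, ← hVd, ← hw0d] at hdrop
  rw [← hUd, ← hVd, ← hw0d, ← hWd] at hwdef
  rw [← hUd, ← hVd, ← hw0d] at hcol
  rw [← hUd] at hU0 hUM
  rw [← hw0d] at hwk
  rw [← hWd] at hwk1
  rw [← hUd, ← hVd, ← hWd, ← hw0d]
  obtain ⟨g, hg⟩ : ∃ g, g = gradW p ε a b x t y s U V w0 := ⟨_, rfl⟩
  rw [← hg] at hwdef
  obtain ⟨R, hR⟩ : ∃ R, R = ∑ i, |∑ j, Real.exp ((U i + V j - costM p x t y s w0 i j) / ε)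
    * (a i * b j) - a i| := ⟨_, rfl⟩
  rw [← hR] at hdrop
  have hR0 : 0 ≤ R := hR ▸ Finset.sum_nonneg fun i _ => abs_nonneg _
  obtain ⟨A, hA⟩ : ∃ A, A = T ^ 2 / ε * Real.exp (6 * M / ε) := ⟨_, rfl⟩
  have hA0 : 0 ≤ A := by rw [hA]; positivity
  have hmass : ∑ i, ∑ j, Real.exp ((U i + V j - costM p x t y s w0 i j) / ε) * (a i * b j) = 1 := by
    rw [Finset.sum_comm]; simp only [hcol, hb1]
  have hlin : ∀ c : ℝ, ∑ i, ∑ j, (c * tildeC p x t y s i j) *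
      (Real.exp ((U i + V j - costM p x t y s w0 i j) / ε) * (a i * b j)) = -c * g := by
    intro c
    rw [hg]; unfold gradW
    rw [neg_mul_neg]
    simp only [Finset.mul_sum]
    exact Finset.sum_congr rfl fun i _ => Finset.sum_congr rfl fun j _ => by ring
  -- variational inequality
  have hVI : ∀ w' ∈ Set.Icc (0 : ℝ) 1, g * (W - w') ≤ A * ((w0 - W) * (W - w')) := by
    intro w' hw'
    rcases hT0.eq_or_lt with hTz | hTp
    · have hA' : A = 0 := by rw [hA, ← hTz]; simp
      have hg' : g = 0 := by
        have : ∀ i j, tildeC p x t y s i j = 0 := fun i j =>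
          abs_eq_zero.mp (le_antisymm (hTz ▸ htT i j) (abs_nonneg _))
        rw [hg]; unfold gradW; simp [this]
      rw [hA', hg']; simp
    · have hAη : A * η = 1 := by
        have : Real.exp (6 * M / ε) * Real.exp (-(6 * M) / ε) = 1 := by
          rw [← Real.exp_add, neg_div]; simp
        rw [hA, hη]
        have hTne := hTp.ne'
        calc _ = (T ^ 2 / ε * (ε / T ^ 2)) *
            (Real.exp (6 * M / ε) * Real.exp (-(6 * M) / ε)) := by ring
          _ = 1 := by rw [this]; field_simp
      have hproj : 0 ≤ (w0 - η * g - W) * (W - w') := by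
        rw [hwdef]
        rcases le_total (w0 - η * g) 0 with hc | hc
        · rw [max_eq_left hc, min_eq_right zero_le_one]
          nlinarith [hw'.1]
        · rw [max_eq_right hc]
          rcases le_total 1 (w0 - η * g) with hd | hd
          · rw [min_eq_left hd]; nlinarith [hw'.2]
          · rw [min_eq_right hd]; simp
      have h3 := mul_nonneg hA0 hproj
      have h4 : A * ((w0 - η * g - W) * (W - w')) =
        A * ((w0 - W) * (W - w')) - (A * η) * (g * (W - w')) := by ring
      rw [h4, hAη] at h3
      linarith
  obtain ⟨Δ, hΔ⟩ : ∃ Δ, Δ = |w0 - W| := ⟨_, rfl⟩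
  have hΔ0 : 0 ≤ Δ := hΔ ▸ abs_nonneg _
  have hΔ1 : Δ ≤ 1 := by
    rw [hΔ, abs_le]; constructor <;> linarith [hwk.1, hwk.2, hwk1.1, hwk1.2]
  have hΔsq : Δ ^ 2 = (w0 - W) ^ 2 := by rw [hΔ, sq_abs]
  -- smoothness
  have hsm : Gob ε a b (costM p x t y s W) U V - Gob ε a b (costM p x t y s w0) U V ≤
      g * (W - w0) + 3 / 4 * (A * Δ ^ 2) := by
    have h3 := G_smooth ε hε a b ha hb (costM p x t y s w0) (costM p x t y s W) U V (Δ * T) M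
      (by
        intro i j
        rw [hCd, abs_mul, ← hΔ]
        exact mul_le_mul_of_nonneg_left (htT i j) hΔ0)
      ((mul_le_of_le_one_left hT0 hΔ1).trans hTM) hmass
    simp only [hCd] at h3
    rw [hlin] at h3
    have h4 : (Δ * T) ^ 2 / ε * Real.exp (M / ε) ≤ A * Δ ^ 2 := by
      have h5 : Real.exp (M / ε) ≤ Real.exp (6 * M / ε) := by
        rw [Real.exp_le_exp]; gcongr; linarith
      have h6 : A * Δ ^ 2 = (Δ * T) ^ 2 / ε * Real.exp (6 * M / ε) := by rw [hA]; ring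
      rw [h6]
      exact mul_le_mul_of_nonneg_left h5 (by positivity)
    linarith
  have hwdrop : A / 4 * Δ ^ 2 ≤
      Gob ε a b (costM p x t y s w0) U V - Gob ε a b (costM p x t y s W) U V := by
    have h3 := hVI w0 hwk
    have h4 : A * ((w0 - W) * (W - w0)) = -(A * Δ ^ 2) := by rw [hΔsq]; ring
    linarith
  -- gap bound
  have hgap : ∀ ζ : (Fin m → ℝ) × (Fin n → ℝ) × ℝ, ζ ∈ feasSet a →
      Gob ε a b (costM p x t y s W) U V - (2 * M * R + 7 / 4 * (A * Δ)) ≤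
        Fobj p ε a b x t y s ζ.1 ζ.2.1 ζ.2.2 := by
    rintro ⟨u', v', w'⟩ ⟨hu', hw'⟩
    simp only at hu' hw' ⊢
    rw [hFG]
    obtain ⟨U', hU'⟩ : ∃ U' : Fin m → ℝ, U' = (fun i =>
      -ε * Real.log (∑ j, Real.exp (-costM p x t y s w' i j / ε) *
          (Real.exp (v' j / ε) * b j)) +
        ε * ∑ i', a i' * Real.log (∑ j, Real.exp (-costM p x t y s w' i' j / ε) *
          (Real.exp (v' j / ε) * b j))) := ⟨_, rfl⟩
    obtain ⟨V', hV'⟩ : ∃ V' : Fin n → ℝ, V' = (fun j =>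
      -ε * Real.log (∑ i, Real.exp (-costM p x t y s w' i j / ε) *
          (Real.exp (U' i / ε) * a i))) := ⟨_, rfl⟩
    obtain ⟨-, hUM', -, hd'⟩ := step w' hw' v' V' U' hU' hV'
    have hd' := hd' u' hu'
    have hd0 : 0 ≤ Gob ε a b (costM p x t y s w') u' v' - Gob ε a b (costM p x t y s w') U' V' :=
      le_trans (by positivity) hd'
    have hcv := G_convex ε hε a b ha hb (costM p x t y s w0) (costM p x t y s w') U U' V V' hcol
    simp only [hCd] at hcv
    rw [hlin] at hcv
    have hRb : ∑ i, (∑ j, Real.exp ((U i + V j - costM p x t y s w0 i j) / ε) * (a i * b j) - a i)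
        * (U i - U' i) ≤ 2 * M * R := by
      rw [hR, Finset.mul_sum]
      refine Finset.sum_le_sum fun i _ => ?_
      refine (le_abs_self _).trans ?_
      rw [abs_mul, mul_comm]
      apply mul_le_mul_of_nonneg_right _ (abs_nonneg _)
      have := abs_sub (U i) (U' i)
      linarith [hUM i, hUM' i]
    have hv := hVI w' hw'
    have hv2 : (w0 - W) * (W - w') ≤ Δ := by
      refine (le_abs_self _).trans ?_
      rw [abs_mul, ← hΔ]
      have : |W - w'| ≤ 1 := by
        rw [abs_le]; constructor <;> linarith [hw'.1, hw'.2, hwk1.1, hwk1.2]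
      exact mul_le_of_le_one_right hΔ0 this
    have hv3 := mul_le_mul_of_nonneg_left hv2 hA0
    have hΔ2 : A * Δ ^ 2 ≤ A * Δ := mul_le_mul_of_nonneg_left
      (by rw [sq]; exact mul_le_of_le_one_right hΔ0 hΔ1) hA0
    linarith
  have hmem : Gob ε a b (costM p x t y s W) U V ∈ {r : ℝ | ∃ ζ : (Fin m → ℝ) × (Fin n → ℝ) × ℝ,
      ζ ∈ feasSet a ∧ r = Fobj p ε a b x t y s ζ.1 ζ.2.1 ζ.2.2} :=
    ⟨(U, V, W), ⟨hU0, hwk1⟩, rfl⟩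
  have hlow : Gob ε a b (costM p x t y s W) U V - (2 * M * R + 7 / 4 * (A * Δ)) ≤
      Fstar p ε a b x t y s := by
    unfold Fstar
    refine le_csInf ⟨_, hmem⟩ ?_
    rintro r ⟨ζ, hζ, rfl⟩
    exact hgap ζ hζ
  have hup : Fstar p ε a b x t y s ≤ Gob ε a b (costM p x t y s W) U V := by
    unfold Fstar
    refine csInf_le ⟨Gob ε a b (costM p x t y s W) U V - (2 * M * R + 7 / 4 * (A * Δ)), ?_⟩ hmem
    rintro r ⟨ζ, hζ, rfl⟩
    exact hgap ζ hζ
  have hD : ε / 4 * R ^ 2 + A / 4 * Δ ^ 2 ≤ Gob ε a b (costM p x t y s w0) (u k) (v k) -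
      Gob ε a b (costM p x t y s W) U V := by linarith
  obtain ⟨ρ, hρ⟩ : ∃ ρ, ρ = (192 * (m : ℝ) + 216 * (n : ℝ) + 24) * (M ^ 2 / ε) *
            Real.exp (18 * M / ε) := ⟨_, rfl⟩
  rw [← hρ]
  obtain ⟨B, hB⟩ : ∃ B, B = M ^ 2 / ε := ⟨_, rfl⟩
  have hB0 : 0 ≤ B := by rw [hB]; positivity
  have hm' : (1 : ℝ) ≤ m := by exact_mod_cast hm
  have hn' : (1 : ℝ) ≤ n := by exact_mod_cast hn
  have hρB : 432 * (B * Real.exp (18 * M / ε)) ≤ ρ := by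
    rw [hρ, ← hB, mul_assoc]
    apply mul_le_mul_of_nonneg_right (by linarith) (by positivity)
  have hρ1 : 32 * B ≤ ρ := by
    have h3 : 1 ≤ Real.exp (18 * M / ε) := Real.one_le_exp (by positivity)
    have h4 := mul_le_mul_of_nonneg_left h3 hB0
    linarith
  have hρ2 : 49 / 2 * A ≤ ρ := by
    have h3 : A ≤ B * Real.exp (18 * M / ε) := by
      rw [hA, hB]
      gcongr
      linarith
    have : 0 ≤ B * Real.exp (18 * M / ε) := by positivity
    linarith
  have hρ0 : 0 ≤ ρ := by linarith
  have hBε : B * ε = M ^ 2 := by rw [hB]; field_simp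
  calc _ ≤ (2 * M * R + 7 / 4 * (A * Δ)) ^ 2 := by
        apply pow_le_pow_left₀ <;> linarith
    _ ≤ 32 * B * (ε / 4 * R ^ 2) + 49 / 2 * A * (A / 4 * Δ ^ 2) := by
        have : 32 * B * (ε / 4 * R ^ 2) = 8 * M ^ 2 * R ^ 2 := by rw [← hBε]; ring
        rw [this]
        nlinarith [sq_nonneg (2 * M * R - 7 / 4 * (A * Δ))]
    _ ≤ ρ * (ε / 4 * R ^ 2) + ρ * (A / 4 * Δ ^ 2) := by
        gcongr
    _ = ρ * (ε / 4 * R ^ 2 + A / 4 * Δ ^ 2) := by ring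
    _ ≤ _ := mul_le_mul_of_nonneg_left hD hρ0
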